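/- Let P : C →_A C' be an execution step in which at least one bad node of C becomes non-bad in C' without being activated (i.e., there exists u ∈ B \ A with u ∉ B'). Then the number of bad nodes strictly decreases: |B'| < |B|. -/

import Mathlib

open scoped Classical

/-- A pre-configuration: a finite node set `V` with a partial parent map
(`none` means the node has no parent) and an integer height assignment. -/
structure PreConfig (V : Type*) where
  parent : V → Option V
  height : V → ℤ

namespace PreConfig

variable {V : Type*} [Fintype V] [LinearOrder V]

/-- The children of `u` are the nodes whose parent is `u`. -/
noncomputable def children (C : PreConfig V) (u : V) : Finset V :=
  Finset.univ.filter (fun v => C.parent v = some u)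

/-- A leaf is a node with no children. -/
def IsLeaf (C : PreConfig V) (u : V) : Prop := C.children u = ∅

/-- Maximum height value among the children of `u` (junk value `0` for a leaf). -/
noncomputable def maxH (C : PreConfig V) (u : V) : ℤ :=
  if h : (C.children u).Nonempty then (C.children u).sup' h C.height else 0

/-- Minimum height value among the children of `u` (junk value `0` for a leaf). -/
noncomputable def minH (C : PreConfig V) (u : V) : ℤ :=
  if h : (C.children u).Nonempty then (C.children u).inf' h C.height else 0

/-- A child of `u` of maximum height value; ties broken by a fixed rule
(smallest ID). Junk value `u` for a leaf. -/
noncomputable def maxChild (C : PreConfig V) (u : V) : V :=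
  if h : ((C.children u).filter fun v => C.height v = C.maxH u).Nonempty
  then ((C.children u).filter fun v => C.height v = C.maxH u).min' h else u

/-- A child of `u` of minimum height value; ties broken by a fixed rule
(smallest ID). Junk value `u` for a leaf. -/
noncomputable def minChild (C : PreConfig V) (u : V) : V :=
  if h : ((C.children u).filter fun v => C.height v = C.minH u).Nonempty
  then ((C.children u).filter fun v => C.height v = C.minH u).min' h else u

/-- `stable(u)`: `h(u) = 0` if `u` is a leaf, and `h(u) = 1 + max_{w child of u} h(w)` otherwise. -/
def Stable (C : PreConfig V) (u : V) : Prop :=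
  (C.IsLeaf u ∧ C.height u = 0) ∨ (¬ C.IsLeaf u ∧ C.height u = 1 + C.maxH u)

/-- `balanced(u)`: `|h(z) − h(z')| ≤ α` for all children `z, z'` of `u`. -/
def Balanced (α : ℤ) (C : PreConfig V) (u : V) : Prop :=
  ∀ z ∈ C.children u, ∀ z' ∈ C.children u, |C.height z - C.height z'| ≤ α

/-- `u` is enabled for a height update iff `¬stable(u)`. -/
def UpdateEnabled (C : PreConfig V) (u : V) : Prop := ¬ C.Stable u

/-- `u` is enabled for a swap iff `stable(u) ∧ stable(max(u)) ∧ ¬balanced(u)`. -/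
def SwapEnabled (α : ℤ) (C : PreConfig V) (u : V) : Prop :=
  C.Stable u ∧ C.Stable (C.maxChild u) ∧ ¬ Balanced α C u

/-- `u` is enabled iff it is enabled for a height update or for a swap. -/
def Enabled (α : ℤ) (C : PreConfig V) (u : V) : Prop :=
  C.UpdateEnabled u ∨ SwapEnabled α C u

/-- The value written by a height update: `0` for a leaf, `1 + max_{w child of u} h(w)` otherwise. -/
noncomputable def newHeight (C : PreConfig V) (u : V) : ℤ :=
  if C.IsLeaf u then 0 else 1 + C.maxH u

/-- A bad node: an internal node `u` with `h(u) ≤ max_{v child of u} h(v)`,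
or a leaf `u` with `h(u) < 0`. -/
def Bad (C : PreConfig V) (u : V) : Prop :=
  (¬ C.IsLeaf u ∧ C.height u ≤ C.maxH u) ∨ (C.IsLeaf u ∧ C.height u < 0)

/-- `v` reaches `a` by iterating the parent map. -/
def Reaches (C : PreConfig V) (v a : V) : Prop :=
  Relation.ReflTransGen (fun x y => C.parent x = some y) v a

/-- The underlying graph is a rooted tree with root `r`: `r` has no parent,
every other node has a (unique) parent, and every node reaches `r` by
iterating the parent map. -/
def IsTree (C : PreConfig V) (r : V) : Prop :=
  C.parent r = none ∧ (∀ v, C.parent v = none → v = r) ∧ ∀ v, C.Reaches v r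

/-- The subtree `S_u` of `u`: the set of descendants of `u` (including `u`). -/
def subtree (C : PreConfig V) (u : V) : Set V := {v | C.Reaches v u}

/-- The actual height `h*(u)` of `u`: the length of a longest directed path
going downward from `u` (such a maximal path necessarily ends at a leaf of `S_u`). -/
noncomputable def hstar (C : PreConfig V) (u : V) : ℕ :=
  sSup {n : ℕ | ∃ f : ℕ → V, f 0 = u ∧ ∀ i < n, C.parent (f (i + 1)) = some (f i)}

/-- An execution step `C →_A C'`: a nonempty set `A` of nodes enabled in `C` is
activated simultaneously; each `u ∈ A` enabled for a height update sets its height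
to `newHeight`; each `u ∈ A` enabled for a swap replaces the edges `(u, min(u))` and
`(max(u), max(max(u)))` by `(u, max(max(u)))` and `(max(u), min(u))` (all guards and
functions evaluated in `C`); everything else is unchanged. -/
structure Step (α : ℤ) (C C' : PreConfig V) (A : Finset V) : Prop where
  nonempty : A.Nonempty
  all_enabled : ∀ u ∈ A, Enabled α C u
  height_update : ∀ u ∈ A, C.UpdateEnabled u → C'.height u = C.newHeight u
  height_keep : ∀ u, ¬ (u ∈ A ∧ C.UpdateEnabled u) → C'.height u = C.height u
  swap_out : ∀ u ∈ A, SwapEnabled α C u → C'.parent (C.minChild u) = some (C.maxChild u)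
  swap_in : ∀ u ∈ A, SwapEnabled α C u → C'.parent (C.maxChild (C.maxChild u)) = some u
  parent_keep : ∀ v, (∀ u ∈ A, SwapEnabled α C u →
      v ≠ C.minChild u ∧ v ≠ C.maxChild (C.maxChild u)) → C'.parent v = C.parent v

end PreConfig

namespace PreConfig

variable {V : Type*} [Fintype V] [LinearOrder V]

theorem mem_children {C : PreConfig V} {u v : V} : v ∈ C.children u ↔ C.parent v = some u := by
  simp [children]

theorem not_isLeaf_of_parent {C : PreConfig V} {u v : V} (h : C.parent v = some u) :
    ¬ C.IsLeaf u := fun hl => by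
  have := mem_children.2 h
  rw [show C.children u = ∅ from hl] at this
  simp at this

theorem exists_parent_of_not_isLeaf {C : PreConfig V} {u : V} (h : ¬ C.IsLeaf u) :
    ∃ v, C.parent v = some u := by
  obtain ⟨v, hv⟩ := Finset.nonempty_iff_ne_empty.2 h
  exact ⟨v, mem_children.1 hv⟩

theorem height_le_maxH {C : PreConfig V} {u v : V} (h : C.parent v = some u) :
    C.height v ≤ C.maxH u := by
  have hv := mem_children.2 h
  rw [maxH, dif_pos ⟨v, hv⟩]
  exact Finset.le_sup' C.height hv

theorem exists_height_eq_maxH {C : PreConfig V} {u : V} (h : ¬ C.IsLeaf u) :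
    ∃ v ∈ C.children u, C.height v = C.maxH u := by
  have hne := Finset.nonempty_iff_ne_empty.2 h
  obtain ⟨v, hv, he⟩ := Finset.exists_mem_eq_sup' hne C.height
  exact ⟨v, hv, by rw [maxH, dif_pos hne, he]⟩

theorem minH_le_height {C : PreConfig V} {u v : V} (h : C.parent v = some u) :
    C.minH u ≤ C.height v := by
  have hv := mem_children.2 h
  rw [minH, dif_pos ⟨v, hv⟩]
  exact Finset.inf'_le C.height hv

theorem exists_height_eq_minH {C : PreConfig V} {u : V} (h : ¬ C.IsLeaf u) :
    ∃ v ∈ C.children u, C.height v = C.minH u := by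
  have hne := Finset.nonempty_iff_ne_empty.2 h
  obtain ⟨v, hv, he⟩ := Finset.exists_mem_eq_inf' hne C.height
  exact ⟨v, hv, by rw [minH, dif_pos hne, he]⟩

theorem maxChild_spec {C : PreConfig V} {u : V} (h : ¬ C.IsLeaf u) :
    C.parent (C.maxChild u) = some u ∧ C.height (C.maxChild u) = C.maxH u := by
  have hne : ((C.children u).filter fun v => C.height v = C.maxH u).Nonempty := by
    obtain ⟨v, hv, he⟩ := exists_height_eq_maxH h
    exact ⟨v, Finset.mem_filter.2 ⟨hv, he⟩⟩
  have hm := Finset.mem_filter.1 (Finset.min'_mem _ hne)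
  rw [maxChild, dif_pos hne]
  exact ⟨mem_children.1 hm.1, hm.2⟩

theorem minChild_spec {C : PreConfig V} {u : V} (h : ¬ C.IsLeaf u) :
    C.parent (C.minChild u) = some u ∧ C.height (C.minChild u) = C.minH u := by
  have hne : ((C.children u).filter fun v => C.height v = C.minH u).Nonempty := by
    obtain ⟨v, hv, he⟩ := exists_height_eq_minH h
    exact ⟨v, Finset.mem_filter.2 ⟨hv, he⟩⟩
  have hm := Finset.mem_filter.1 (Finset.min'_mem _ hne)
  rw [minChild, dif_pos hne]
  exact ⟨mem_children.1 hm.1, hm.2⟩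

theorem maxChild_of_isLeaf {C : PreConfig V} {u : V} (h : C.IsLeaf u) : C.maxChild u = u := by
  rw [maxChild, dif_neg]
  rw [show C.children u = ∅ from h]
  simp

theorem not_isLeaf_of_swapEnabled {α : ℤ} {C : PreConfig V} {u : V} (h : SwapEnabled α C u) :
    ¬ C.IsLeaf u := fun hl => by
  refine h.2.2 fun z hz => ?_
  rw [show C.children u = ∅ from hl] at hz
  simp at hz

theorem height_maxChild_of_swapEnabled {α : ℤ} {C : PreConfig V} {u : V}
    (h : SwapEnabled α C u) : C.height u = 1 + C.height (C.maxChild u) := by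
  have hl := not_isLeaf_of_swapEnabled h
  rw [(maxChild_spec hl).2]
  rcases h.1 with h1 | h1
  · exact absurd h1.1 hl
  · exact h1.2

theorem height_minChild_lt_height_maxChild {α : ℤ} (hα : 0 ≤ α) {C : PreConfig V} {u : V}
    (h : SwapEnabled α C u) : C.height (C.minChild u) < C.height (C.maxChild u) := by
  have hl := not_isLeaf_of_swapEnabled h
  rw [(maxChild_spec hl).2, (minChild_spec hl).2]
  by_contra! hle
  refine h.2.2 fun z hz z' hz' => ?_
  have h1 := height_le_maxH (mem_children.1 hz)
  have h2 := height_le_maxH (mem_children.1 hz')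
  have h3 := minH_le_height (mem_children.1 hz)
  have h4 := minH_le_height (mem_children.1 hz')
  rw [abs_le]
  constructor <;> linarith

theorem height_maxChild_lt_of_stable {C : PreConfig V} {u : V} (hl : ¬ C.IsLeaf u)
    (h : C.Stable u) : C.height (C.maxChild u) < C.height u := by
  rw [(maxChild_spec hl).2]
  rcases h with h1 | h1
  · exact absurd h1.1 hl
  · omega

theorem Step.parent_cases {α : ℤ} {C C' : PreConfig V} {A : Finset V} (hs : Step α C C' A)
    {x v : V} (h : C'.parent x = some v) :
    C.parent x = some v ∨ ∃ u ∈ A, SwapEnabled α C u ∧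
      ((x = C.minChild u ∧ v = C.maxChild u) ∨ (x = C.maxChild (C.maxChild u) ∧ v = u)) := by
  by_cases hk : ∀ u ∈ A, SwapEnabled α C u → x ≠ C.minChild u ∧ x ≠ C.maxChild (C.maxChild u)
  · exact Or.inl (hs.parent_keep x hk ▸ h)
  · push Not at hk
    obtain ⟨u, hu, hsw, hx⟩ := hk
    refine Or.inr ⟨u, hu, hsw, ?_⟩
    by_cases hm : x = C.minChild u
    · have := hs.swap_out u hu hsw
      rw [← hm, h, Option.some.injEq] at this
      exact Or.inl ⟨hm, this⟩
    · have hx := hx hm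
      have := hs.swap_in u hu hsw
      rw [← hx, h, Option.some.injEq] at this
      exact Or.inr ⟨hx, this⟩

theorem Step.parent_eq_of_unstable {α : ℤ} {C C' : PreConfig V} {A : Finset V}
    (hs : Step α C C' A) {x v : V} (h : C'.parent x = some v) (hv : ¬ C.Stable v) :
    C.parent x = some v := by
  rcases hs.parent_cases h with h | ⟨u, -, hsw, ⟨-, rfl⟩ | ⟨-, rfl⟩⟩
  · exact h
  · exact absurd hsw.2.1 hv
  · exact absurd hsw.1 hv

theorem Step.isLeaf_of_isLeaf {α : ℤ} {C C' : PreConfig V} {A : Finset V}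
    (hs : Step α C C' A) {v : V} (h : C'.IsLeaf v) : C.IsLeaf v := by
  by_contra hl
  obtain ⟨x, hx⟩ := exists_parent_of_not_isLeaf hl
  by_cases hk : ∀ u ∈ A, SwapEnabled α C u → x ≠ C.minChild u ∧ x ≠ C.maxChild (C.maxChild u)
  · exact not_isLeaf_of_parent ((hs.parent_keep x hk).trans hx) h
  · push Not at hk
    obtain ⟨u, hu, hsw, hxu⟩ := hk
    have hul := not_isLeaf_of_swapEnabled hsw
    have hin := not_isLeaf_of_parent (hs.swap_in u hu hsw)
    have hout := not_isLeaf_of_parent (hs.swap_out u hu hsw)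
    by_cases hm : x = C.minChild u
    · have := (minChild_spec hul).1
      rw [← hm, hx, Option.some.injEq] at this
      exact hin (this ▸ h)
    · have hxM := hxu hm
      by_cases hM : C.IsLeaf (C.maxChild u)
      · have := (maxChild_spec hul).1
        rw [maxChild_of_isLeaf hM] at hxM
        rw [← hxM, hx, Option.some.injEq] at this
        exact hin (this ▸ h)
      · have := (maxChild_spec hM).1
        rw [← hxM, hx, Option.some.injEq] at this
        exact hout (this ▸ h)

/-- A node whose height increases is an activated, unstable, bad node. -/
theorem Step.of_height_lt {α : ℤ} {C C' : PreConfig V} {A : Finset V} (hs : Step α C C' A)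
    {x : V} (h : C.height x < C'.height x) : x ∈ A ∧ ¬ C.Stable x ∧ C.Bad x := by
  by_cases hu : x ∈ A ∧ C.UpdateEnabled x
  · refine ⟨hu.1, hu.2, ?_⟩
    rw [hs.height_update x hu.1 hu.2, newHeight] at h
    by_cases hl : C.IsLeaf x
    · rw [if_pos hl] at h
      exact Or.inr ⟨hl, h⟩
    · rw [if_neg hl] at h
      exact Or.inl ⟨hl, by omega⟩
  · rw [hs.height_keep x hu] at h
    exact absurd h (lt_irrefl _)

/-- A bad node of the new configuration that is either newly bad or freshly updated
has a new child whose height increased. -/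
theorem Step.exists_height_lt {α : ℤ} (hα : 0 ≤ α) {C C' : PreConfig V} {A : Finset V}
    (hs : Step α C C' A) {v : V} (hb : C'.Bad v)
    (hv : ¬ C.Bad v ∨ (v ∈ A ∧ ¬ C.Stable v)) :
    ∃ x, C'.parent x = some v ∧ C.height x < C'.height x := by
  rcases hb with ⟨hl, hle⟩ | ⟨hl, hlt⟩
  · obtain ⟨hx, hxh⟩ := maxChild_spec hl
    rw [← hxh] at hle
    refine ⟨C'.maxChild v, hx, lt_of_lt_of_le ?_ hle⟩
    generalize C'.maxChild v = x at hx
    rcases hs.parent_cases hx with hp | ⟨u, hu, hsw, ⟨rfl, rfl⟩ | ⟨rfl, rfl⟩⟩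
    · have hm := height_le_maxH hp
      have hlC := not_isLeaf_of_parent hp
      by_cases hup : v ∈ A ∧ C.UpdateEnabled v
      · rw [hs.height_update v hup.1 hup.2, newHeight, if_neg hlC]
        omega
      · rw [hs.height_keep v hup]
        have hnb := hv.resolve_right hup
        by_contra hc
        exact hnb (Or.inl ⟨hlC, by omega⟩)
    · rw [hs.height_keep _ fun h => h.2 hsw.2.1]
      exact height_minChild_lt_height_maxChild hα hsw
    · rw [hs.height_keep _ fun h => h.2 hsw.1]
      have h1 := height_maxChild_of_swapEnabled hsw
      by_cases hM : C.IsLeaf (C.maxChild v)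
      · rw [maxChild_of_isLeaf hM]
        omega
      · have := height_maxChild_lt_of_stable hM hsw.2.1
        omega
  · exfalso
    have hlC := hs.isLeaf_of_isLeaf hl
    by_cases hup : v ∈ A ∧ C.UpdateEnabled v
    · rw [hs.height_update v hup.1 hup.2, newHeight, if_pos hlC] at hlt
      exact lt_irrefl _ hlt
    · rw [hs.height_keep v hup] at hlt
      exact hv.resolve_right hup (Or.inr ⟨hlC, hlt⟩)

theorem IsTree.wellFounded {W : Type*} [Finite W] {C : PreConfig W} {r : W} (hT : C.IsTree r) :
    WellFounded fun x y => C.parent x = some y := by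
  let R : W → W → Prop := fun x y => C.parent x = some y
  have hirr : ∀ v, ¬ Relation.TransGen R v v := by
    intro v
    induction hT.2.2 v using Relation.ReflTransGen.head_induction_on with
    | refl =>
      intro h
      obtain ⟨b, hb, -⟩ := Relation.TransGen.head'_iff.1 h
      exact absurd (hT.1.symm.trans hb) (by simp)
    | @head a c hac _ ih =>
      intro h
      obtain ⟨b, hb, hba⟩ := Relation.TransGen.head'_iff.1 h
      obtain rfl : c = b := Option.some.inj (hac.symm.trans hb)
      exact ih (Relation.TransGen.tail' hba hac)
  have : Std.Irrefl (Relation.TransGen R) := ⟨hirr⟩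
  exact Subrelation.wf (r := Relation.TransGen R) (fun h => Relation.TransGen.single h)
    (Finite.wellFounded_of_trans_of_irrefl (Relation.TransGen R))

/-- Below a node whose height increased, along edges of the new tree leaving old bad nodes,
there is an activated bad node that is no longer bad after the step. -/
theorem Step.exists_repaired {α : ℤ} (hα : 0 ≤ α) {C C' : PreConfig V} {A : Finset V} {r : V}
    (hT : C.IsTree r) (hs : Step α C C' A) (x : V) (hx : C.height x < C'.height x) :
    ∃ w, C.Bad w ∧ ¬ C'.Bad w ∧ w ∈ A ∧
      Relation.ReflTransGen (fun a b => C'.parent a = some b ∧ C.Bad a) w x := by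
  induction x using hT.wellFounded.induction with
  | _ x ih =>
    obtain ⟨hA, hst, hb⟩ := hs.of_height_lt hx
    by_cases hb' : C'.Bad x
    · obtain ⟨y, hy, hlt⟩ := hs.exists_height_lt hα hb' (Or.inr ⟨hA, hst⟩)
      obtain ⟨w, h1, h2, h3, h4⟩ := ih y (hs.parent_eq_of_unstable hy hst) hlt
      exact ⟨w, h1, h2, h3, h4.tail ⟨hy, (hs.of_height_lt hlt).2.2⟩⟩
    · exact ⟨x, hb, hb', hA, .refl⟩

end PreConfig

/-- Let `C →_A C'` be an execution step in which at least one bad node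
of `C` becomes non-bad in `C'` without being activated. Then the number of bad nodes
strictly decreases: `|B'| < |B|`. -/
theorem stmt19 {V : Type*} [Fintype V] [LinearOrder V] (α : ℤ) (hα : 1 ≤ α)
    (C C' : PreConfig V) (A : Finset V) (r : V)
    (hT : C.IsTree r) (hstep : PreConfig.Step α C C' A)
    (hex : ∃ u, C.Bad u ∧ u ∉ A ∧ ¬ C'.Bad u) :
    {u | C'.Bad u}.ncard < {u | C.Bad u}.ncard := by
  obtain ⟨u, hu, huA, hu'⟩ := hex
  have hα0 : 0 ≤ α := by omega
  let Q : V → V → Prop := fun a b => C'.parent a = some b ∧ C.Bad a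
  have hQ : Relator.RightUnique Q := fun a b c hb hc =>
    Option.some.inj (hb.1.symm.trans hc.1)
  have hterm : ∀ {a b : V}, ¬ C.Bad a → Relation.ReflTransGen Q a b → a = b := by
    intro a b ha h
    rcases h.cases_head with h | ⟨c, hc, -⟩
    · exact h
    · exact absurd hc.2 ha
  have key : ∀ v, C'.Bad v → ¬ C.Bad v →
      ∃ w, C.Bad w ∧ ¬ C'.Bad w ∧ w ∈ A ∧ Relation.ReflTransGen Q w v := by
    intro v hv' hv
    obtain ⟨x, hx, hlt⟩ := hstep.exists_height_lt hα0 hv' (Or.inl hv)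
    obtain ⟨w, h1, h2, h3, h4⟩ := hstep.exists_repaired hα0 hT x hlt
    exact ⟨w, h1, h2, h3, h4.tail ⟨hx, (hstep.of_height_lt hlt).2.2⟩⟩
  choose! f hf using key
  have hinj : Set.InjOn f ({u | C'.Bad u} \ {u | C.Bad u}) := by
    intro v hv w hw hvw
    have h1 := (hf v hv.1 hv.2).2.2.2
    have h2 := (hf w hw.1 hw.2).2.2.2
    rw [← hvw] at h2
    rcases Relation.ReflTransGen.total_of_right_unique hQ h1 h2 with h | h
    · exact hterm hv.2 h
    · exact (hterm hw.2 h).symm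
  have himg : f '' ({u | C'.Bad u} \ {u | C.Bad u}) ⊂ {u | C.Bad u} \ {u | C'.Bad u} := by
    refine (Set.ssubset_iff_of_subset ?_).2 ⟨u, ⟨hu, hu'⟩, ?_⟩
    · rintro _ ⟨v, hv, rfl⟩
      exact ⟨(hf v hv.1 hv.2).1, (hf v hv.1 hv.2).2.1⟩
    · rintro ⟨v, hv, rfl⟩
      exact huA (hf v hv.1 hv.2).2.2.1
  have hlt := Set.ncard_lt_ncard himg
  rw [hinj.ncard_image] at hlt
  have e1 := Set.ncard_inter_add_ncard_sdiff_eq_ncard {u | C'.Bad u} {u | C.Bad u}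
  have e2 := Set.ncard_inter_add_ncard_sdiff_eq_ncard {u | C.Bad u} {u | C'.Bad u}
  rw [Set.inter_comm] at e2
  omega
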